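/- arXiv:2307.10042 — 5 statements merged into one kernel-verified Lean document; each statement's English description precedes it below -/
import Mathlib

section
/- For any ρ ≥ 1 and any three discrete probability distributions μ, ν, ξ supported on a common finite set of points x_1,…,x_N ∈ ℝ^d, the ℓ_ρ-optimal-transport cost satisfies the triangle inequality: R_ρ(μ, ξ) ≤ R_ρ(μ, ν) + R_ρ(ν, ξ). -/
open Finset

noncomputable section

/-- A coupling of two discrete distributions given by weight vectors. -/
def IsCoupling {n m : ℕ} (μ : Fin n → ℝ) (ν : Fin m → ℝ) (γ : Fin n → Fin m → ℝ) : Prop :=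
  (∀ i j, 0 ≤ γ i j) ∧ (∀ i, ∑ j, γ i j = μ i) ∧ (∀ j, ∑ i, γ i j = ν j)

/-- The ℓ_ρ-transport cost of a coupling γ. (With Lean's conventions `x / 0 = 0` and
`0 ^ ρ = 0` for `ρ ≠ 0`, terms with `μ i * ν j = 0` contribute `0`.) -/
def transportCost {d n m : ℕ} (x : Fin n → EuclideanSpace ℝ (Fin d))
    (y : Fin m → EuclideanSpace ℝ (Fin d)) (μ : Fin n → ℝ) (ν : Fin m → ℝ) (ρ : ℝ)
    (γ : Fin n → Fin m → ℝ) : ℝ :=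
  (∑ i, ∑ j, μ i * ν j * ((γ i j / (μ i * ν j)) * ‖x i - y j‖) ^ ρ) ^ (1 / ρ)

/-- The ℓ_ρ-optimal-transport cost `R_ρ(μ, ν)`. -/
def Rrho {d n m : ℕ} (x : Fin n → EuclideanSpace ℝ (Fin d))
    (y : Fin m → EuclideanSpace ℝ (Fin d)) (μ : Fin n → ℝ) (ν : Fin m → ℝ) (ρ : ℝ) : ℝ :=
  sInf {c | ∃ γ, IsCoupling μ ν γ ∧ c = transportCost x y μ ν ρ γ}

/-- Swapping the marginals of a coupling. -/
lemma IsCoupling.transpose {n m : ℕ} {μ : Fin n → ℝ} {ν : Fin m → ℝ} {γ : Fin n → Fin m → ℝ}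
    (h : IsCoupling μ ν γ) : IsCoupling ν μ (fun j i => γ i j) :=
  ⟨fun j i => h.1 i j, h.2.2, h.2.1⟩

/-- A coupling vanishes on the columns where the second marginal vanishes. -/
lemma IsCoupling.eq_zero_of_right {n m : ℕ} {μ : Fin n → ℝ} {ν : Fin m → ℝ}
    {γ : Fin n → Fin m → ℝ} (h : IsCoupling μ ν γ) {j : Fin m} (hj : ν j = 0) (i : Fin n) :
    γ i j = 0 :=
  (Finset.sum_eq_zero_iff_of_nonneg fun i _ => h.1 i j).1 ((h.2.2 j).trans hj) i (mem_univ i)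

/-- The independent coupling of two probability vectors. -/
lemma IsCoupling.prod {n m : ℕ} {μ : Fin n → ℝ} {ν : Fin m → ℝ}
    (hμ0 : ∀ i, 0 ≤ μ i) (hν0 : ∀ j, 0 ≤ ν j) (hμ1 : ∑ i, μ i = 1) (hν1 : ∑ j, ν j = 1) :
    IsCoupling μ ν (fun i j => μ i * ν j) := by
  refine ⟨fun i j => mul_nonneg (hμ0 i) (hν0 j), fun i => ?_, fun j => ?_⟩
  · rw [← Finset.mul_sum, hν1, mul_one]
  · rw [← Finset.sum_mul, hμ1, one_mul]

/-- One marginal of the glued coupling. -/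
lemma IsCoupling.sum_glue {n m l : ℕ} {μ : Fin n → ℝ} {ν : Fin m → ℝ} {ξ : Fin l → ℝ}
    {γ : Fin n → Fin m → ℝ} {η : Fin m → Fin l → ℝ}
    (hγ : IsCoupling μ ν γ) (hη : IsCoupling ν ξ η) (i : Fin n) :
    ∑ k, ∑ j, γ i j * η j k / ν j = μ i := by
  rw [Finset.sum_comm, ← hγ.2.1 i]
  refine Finset.sum_congr rfl fun j _ => ?_
  rw [← Finset.sum_div, ← Finset.mul_sum, hη.2.1 j]
  by_cases hj : ν j = 0
  · simp [hj, hγ.eq_zero_of_right hj i]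
  · exact mul_div_cancel_right₀ _ hj

/-- Gluing two couplings along their common marginal. -/
lemma IsCoupling.glue {n m l : ℕ} {μ : Fin n → ℝ} {ν : Fin m → ℝ} {ξ : Fin l → ℝ}
    {γ : Fin n → Fin m → ℝ} {η : Fin m → Fin l → ℝ} (hν0 : ∀ j, 0 ≤ ν j)
    (hγ : IsCoupling μ ν γ) (hη : IsCoupling ν ξ η) :
    IsCoupling μ ξ (fun i k => ∑ j, γ i j * η j k / ν j) := by
  refine ⟨fun i k => Finset.sum_nonneg fun j _ =>
    div_nonneg (mul_nonneg (hγ.1 i j) (hη.1 j k)) (hν0 j), hγ.sum_glue hη, fun k => ?_⟩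
  rw [← hη.transpose.sum_glue hγ.transpose k]
  simp only [mul_comm]

/-- Averaging along a coupling contracts the weighted `ℓ_ρ` norm (Jensen). -/
lemma IsCoupling.sum_mul_rpow_le {m l : ℕ} {ν : Fin m → ℝ} {ξ : Fin l → ℝ}
    {η : Fin m → Fin l → ℝ} (hη : IsCoupling ν ξ η) (hξ0 : ∀ k, 0 ≤ ξ k)
    {ρ : ℝ} (hρ : 1 ≤ ρ) {g : Fin m → ℝ} (hg : ∀ j, 0 ≤ g j) :
    ∑ k, ξ k * (∑ j, η j k / ξ k * g j) ^ ρ ≤ ∑ j, ν j * g j ^ ρ := by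
  have key : ∀ k, ξ k * (∑ j, η j k / ξ k * g j) ^ ρ ≤ ∑ j, η j k * g j ^ ρ := by
    intro k
    by_cases hk : ξ k = 0
    · rw [hk, zero_mul]
      exact Finset.sum_nonneg fun j _ => mul_nonneg (hη.1 j k) (Real.rpow_nonneg (hg j) _)
    · have hJ := Real.rpow_arith_mean_le_arith_mean_rpow univ (fun j => η j k / ξ k) g
        (fun j _ => div_nonneg (hη.1 j k) (hξ0 k))
        (by rw [← Finset.sum_div, hη.2.2 k, div_self hk]) (fun j _ => hg j) hρ
      refine (mul_le_mul_of_nonneg_left hJ (hξ0 k)).trans_eq ?_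
      rw [Finset.mul_sum]
      refine Finset.sum_congr rfl fun j _ => ?_
      rw [← mul_assoc, mul_div_cancel₀ _ hk]
  refine (Finset.sum_le_sum fun k _ => key k).trans_eq ?_
  rw [Finset.sum_comm]
  exact Finset.sum_congr rfl fun j _ => by rw [← Finset.sum_mul, hη.2.1 j]

/-- Minkowski's inequality for weighted finite sums. -/
lemma weighted_Lp_add_le {ι : Type*} (s : Finset ι) {w f g : ι → ℝ} {ρ : ℝ} (hρ : 1 ≤ ρ)
    (hw : ∀ i, 0 ≤ w i) (hf : ∀ i, 0 ≤ f i) (hg : ∀ i, 0 ≤ g i) :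
    (∑ i ∈ s, w i * (f i + g i) ^ ρ) ^ (1 / ρ) ≤
      (∑ i ∈ s, w i * f i ^ ρ) ^ (1 / ρ) + (∑ i ∈ s, w i * g i ^ ρ) ^ (1 / ρ) := by
  have hρ0 : ρ ≠ 0 := by positivity
  have hscale : ∀ i (a : ℝ), 0 ≤ a → w i * a ^ ρ = (w i ^ (1 / ρ) * a) ^ ρ := by
    intro i a ha
    rw [Real.mul_rpow (Real.rpow_nonneg (hw i) _) ha, ← Real.rpow_mul (hw i),
      one_div_mul_cancel hρ0, Real.rpow_one]
  have h := Real.Lp_add_le_of_nonneg s (f := fun i => w i ^ (1 / ρ) * f i)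
    (g := fun i => w i ^ (1 / ρ) * g i) hρ
    (fun i _ => mul_nonneg (Real.rpow_nonneg (hw i) _) (hf i))
    (fun i _ => mul_nonneg (Real.rpow_nonneg (hw i) _) (hg i))
  simpa only [hscale _ _ (hf _), hscale _ _ (hg _), hscale _ _ (add_nonneg (hf _) (hg _)),
    mul_add] using h

/-- The glued coupling costs at most the sum of the two costs. -/
lemma transportCost_glue_le {d n m l : ℕ} (x : Fin n → EuclideanSpace ℝ (Fin d))
    (y : Fin m → EuclideanSpace ℝ (Fin d)) (z : Fin l → EuclideanSpace ℝ (Fin d))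
    {μ : Fin n → ℝ} {ν : Fin m → ℝ} {ξ : Fin l → ℝ} {ρ : ℝ} (hρ : 1 ≤ ρ)
    (hμ0 : ∀ i, 0 ≤ μ i) (hν0 : ∀ j, 0 ≤ ν j) (hξ0 : ∀ k, 0 ≤ ξ k)
    {γ : Fin n → Fin m → ℝ} {η : Fin m → Fin l → ℝ}
    (hγ : IsCoupling μ ν γ) (hη : IsCoupling ν ξ η) :
    transportCost x z μ ξ ρ (fun i k => ∑ j, γ i j * η j k / ν j) ≤
      transportCost x y μ ν ρ γ + transportCost y z ν ξ ρ η := by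
  have hρ0 : 0 ≤ ρ := by positivity
  have hinv : 0 ≤ 1 / ρ := by positivity
  set G : Fin n → Fin m → ℝ := fun i j => γ i j / (μ i * ν j) * ‖x i - y j‖ with hG
  set H : Fin m → Fin l → ℝ := fun j k => η j k / (ν j * ξ k) * ‖y j - z k‖ with hH
  have hG0 : ∀ i j, 0 ≤ G i j := fun i j =>
    mul_nonneg (div_nonneg (hγ.1 i j) (mul_nonneg (hμ0 i) (hν0 j))) (norm_nonneg _)
  have hH0 : ∀ j k, 0 ≤ H j k := fun j k =>
    mul_nonneg (div_nonneg (hη.1 j k) (mul_nonneg (hν0 j) (hξ0 k))) (norm_nonneg _)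
  set A : Fin n × Fin l → ℝ := fun p => ∑ j, η j p.2 / ξ p.2 * G p.1 j with hA
  set B : Fin n × Fin l → ℝ := fun p => ∑ j, γ p.1 j / μ p.1 * H j p.2 with hB
  have hA0 : ∀ p, 0 ≤ A p := fun p => Finset.sum_nonneg fun j _ =>
    mul_nonneg (div_nonneg (hη.1 j p.2) (hξ0 p.2)) (hG0 p.1 j)
  have hB0 : ∀ p, 0 ≤ B p := fun p => Finset.sum_nonneg fun j _ =>
    mul_nonneg (div_nonneg (hγ.1 p.1 j) (hμ0 p.1)) (hH0 j p.2)
  have hw0 : ∀ p : Fin n × Fin l, 0 ≤ μ p.1 * ξ p.2 := fun p => mul_nonneg (hμ0 _) (hξ0 _)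
  have hσ0 : ∀ i k, 0 ≤ (∑ j, γ i j * η j k / ν j) / (μ i * ξ k) * ‖x i - z k‖ := fun i k =>
    mul_nonneg (div_nonneg ((hγ.glue hν0 hη).1 i k) (hw0 (i, k))) (norm_nonneg _)
  have hpt : ∀ i k, (∑ j, γ i j * η j k / ν j) / (μ i * ξ k) * ‖x i - z k‖ ≤
      A (i, k) + B (i, k) := by
    intro i k
    simp only [hA, hB]
    rw [Finset.sum_div, Finset.sum_mul, ← Finset.sum_add_distrib]
    refine Finset.sum_le_sum fun j _ => ?_
    have h0 : 0 ≤ γ i j * η j k / ν j / (μ i * ξ k) :=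
      div_nonneg (div_nonneg (mul_nonneg (hγ.1 i j) (hη.1 j k)) (hν0 j)) (hw0 (i, k))
    refine (mul_le_mul_of_nonneg_left (norm_sub_le_norm_sub_add_norm_sub _ (y j) _) h0).trans_eq ?_
    simp only [hG, hH, div_eq_mul_inv, mul_inv]
    ring
  have hAle : ∑ p, μ p.1 * ξ p.2 * A p ^ ρ ≤ ∑ i, ∑ j, μ i * ν j * G i j ^ ρ := by
    rw [Fintype.sum_prod_type]
    refine Finset.sum_le_sum fun i _ => ?_
    have h := hη.sum_mul_rpow_le hξ0 hρ (g := G i) (hG0 i)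
    simpa only [hA, mul_assoc, Finset.mul_sum] using mul_le_mul_of_nonneg_left h (hμ0 i)
  have hBle : ∑ p, μ p.1 * ξ p.2 * B p ^ ρ ≤ ∑ j, ∑ k, ν j * ξ k * H j k ^ ρ := by
    rw [Fintype.sum_prod_type_right]
    refine LE.le.trans_eq ?_ Finset.sum_comm
    refine Finset.sum_le_sum fun k _ => ?_
    have h := hγ.transpose.sum_mul_rpow_le hμ0 hρ (g := fun j => H j k) (fun j => hH0 j k)
    simpa only [hB, mul_right_comm _ (ξ k), Finset.sum_mul] using
      mul_le_mul_of_nonneg_right h (hξ0 k)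
  have hle : ∑ i, ∑ k, μ i * ξ k *
      ((∑ j, γ i j * η j k / ν j) / (μ i * ξ k) * ‖x i - z k‖) ^ ρ ≤
      ∑ p, μ p.1 * ξ p.2 * (A p + B p) ^ ρ := by
    rw [Fintype.sum_prod_type]
    exact Finset.sum_le_sum fun i _ => Finset.sum_le_sum fun k _ =>
      mul_le_mul_of_nonneg_left (Real.rpow_le_rpow (hσ0 i k) (hpt i k) hρ0) (hw0 (i, k))
  refine (Real.rpow_le_rpow (Finset.sum_nonneg fun i _ => Finset.sum_nonneg fun k _ =>
    mul_nonneg (hw0 (i, k)) (Real.rpow_nonneg (hσ0 i k) _)) hle hinv).trans ?_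
  refine (weighted_Lp_add_le univ hρ hw0 hA0 hB0).trans (add_le_add ?_ ?_)
  · exact Real.rpow_le_rpow (Finset.sum_nonneg fun p _ =>
      mul_nonneg (hw0 p) (Real.rpow_nonneg (hA0 p) _)) hAle hinv
  · exact Real.rpow_le_rpow (Finset.sum_nonneg fun p _ =>
      mul_nonneg (hw0 p) (Real.rpow_nonneg (hB0 p) _)) hBle hinv

/-- Transport costs of couplings are nonnegative. -/
lemma transportCost_nonneg {d n m : ℕ} (x : Fin n → EuclideanSpace ℝ (Fin d))
    (y : Fin m → EuclideanSpace ℝ (Fin d)) {μ : Fin n → ℝ} {ν : Fin m → ℝ} (ρ : ℝ)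
    (hμ0 : ∀ i, 0 ≤ μ i) (hν0 : ∀ j, 0 ≤ ν j) {γ : Fin n → Fin m → ℝ}
    (hγ : IsCoupling μ ν γ) : 0 ≤ transportCost x y μ ν ρ γ := by
  refine Real.rpow_nonneg (Finset.sum_nonneg fun i _ => Finset.sum_nonneg fun j _ => ?_) _
  have hw := mul_nonneg (hμ0 i) (hν0 j)
  exact mul_nonneg hw (Real.rpow_nonneg
    (mul_nonneg (div_nonneg (hγ.1 i j) hw) (norm_nonneg _)) _)

/-- triangle inequality for `R_ρ` on a common finite support. -/
theorem Rrho_triangle {d N : ℕ} (x : Fin N → EuclideanSpace ℝ (Fin d)) (ρ : ℝ) (hρ : 1 ≤ ρ)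
    (μ ν ξ : Fin N → ℝ)
    (hμ0 : ∀ i, 0 ≤ μ i) (hν0 : ∀ i, 0 ≤ ν i) (hξ0 : ∀ i, 0 ≤ ξ i)
    (hμ1 : ∑ i, μ i = 1) (hν1 : ∑ i, ν i = 1) (hξ1 : ∑ i, ξ i = 1) :
    Rrho x x μ ξ ρ ≤ Rrho x x μ ν ρ + Rrho x x ν ξ ρ := by
  have hbdd : BddBelow {c | ∃ γ, IsCoupling μ ξ γ ∧ c = transportCost x x μ ξ ρ γ} := by
    refine ⟨0, ?_⟩
    rintro c ⟨γ, hγ, rfl⟩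
    exact transportCost_nonneg x x ρ hμ0 hξ0 hγ
  rw [← sub_le_iff_le_add]
  refine le_csInf ⟨_, _, IsCoupling.prod hμ0 hν0 hμ1 hν1, rfl⟩ ?_
  rintro c ⟨γ, hγ, rfl⟩
  rw [sub_le_comm]
  refine le_csInf ⟨_, _, IsCoupling.prod hν0 hξ0 hν1 hξ1, rfl⟩ ?_
  rintro c ⟨η, hη, rfl⟩
  rw [sub_le_iff_le_add']
  exact (csInf_le hbdd ⟨_, hγ.glue hν0 hη, rfl⟩).trans
    (transportCost_glue_le x x x hρ hμ0 hν0 hξ0 hγ hη)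
end
end

section
/- For any ρ ≥ 1 and any discrete probability distributions μ (with weights μ_i > 0 on points x_1,…,x_n ∈ ℝ^d) and ν (with weights ν_j > 0 on points y_1,…,y_m ∈ ℝ^d), one has R_ρ(μ, ν) ≤ (sup_{i,j} 1/(μ_i ν_j))^{(ρ−1)/ρ} · EMD(μ, ν). -/
open Finset

noncomputable section

/-- The Earth Mover's distance. -/
def EMD {d n m : ℕ} (x : Fin n → EuclideanSpace ℝ (Fin d))
    (y : Fin m → EuclideanSpace ℝ (Fin d)) (μ : Fin n → ℝ) (ν : Fin m → ℝ) : ℝ :=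
  sInf {c | ∃ γ, IsCoupling μ ν γ ∧ c = ∑ i, ∑ j, γ i j * ‖x i - y j‖}

/-- One summand of the transport cost, bounded in terms of upper bounds on `1 / w` and on `a`. -/
theorem mul_div_rpow_le {w a C S ρ : ℝ} (hρ : 1 ≤ ρ) (hw : 0 < w) (ha : 0 ≤ a)
    (hC : 1 / w ≤ C) (hS : a ≤ S) : w * (a / w) ^ ρ ≤ a * (C * S) ^ (ρ - 1) := by
  have hdiv : 0 ≤ a / w := by positivity
  have hsplit : (a / w) ^ ρ = (a / w) * (a / w) ^ (ρ - 1) := by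
    rw [← Real.rpow_one_add' hdiv (by linarith)]
    ring_nf
  have hle : a / w ≤ C * S := by
    rw [div_eq_mul_one_div, mul_comm]
    exact mul_le_mul hC hS ha ((one_div_pos.2 hw).le.trans hC)
  rw [hsplit, ← mul_assoc, mul_div_cancel₀ _ hw.ne']
  exact mul_le_mul_of_nonneg_left (Real.rpow_le_rpow hdiv hle (by linarith)) ha

/-- The `ℓ_ρ`-cost of a nonnegative plan is controlled by its linear cost. -/
theorem transportCost_le {d n m : ℕ} (x : Fin n → EuclideanSpace ℝ (Fin d))
    (y : Fin m → EuclideanSpace ℝ (Fin d)) {μ : Fin n → ℝ} {ν : Fin m → ℝ} {ρ C : ℝ}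
    (hρ : 1 ≤ ρ) (hμ0 : ∀ i, 0 < μ i) (hν0 : ∀ j, 0 < ν j) (hC0 : 0 ≤ C)
    (hC : ∀ i j, 1 / (μ i * ν j) ≤ C) {γ : Fin n → Fin m → ℝ} (hγ : ∀ i j, 0 ≤ γ i j) :
    transportCost x y μ ν ρ γ ≤ C ^ ((ρ - 1) / ρ) * ∑ i, ∑ j, γ i j * ‖x i - y j‖ := by
  have hρ0 : 0 < ρ := by linarith
  have ha : ∀ i j, 0 ≤ γ i j * ‖x i - y j‖ := fun i j => mul_nonneg (hγ i j) (norm_nonneg _)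
  set S := ∑ i, ∑ j, γ i j * ‖x i - y j‖ with hS
  have hS0 : 0 ≤ S := sum_nonneg fun i _ => sum_nonneg fun j _ => ha i j
  have haS : ∀ i j, γ i j * ‖x i - y j‖ ≤ S := fun i j =>
    (single_le_sum (f := fun j => γ i j * ‖x i - y j‖) (fun j _ => ha i j) (mem_univ j)).trans
      (single_le_sum (f := fun i => ∑ j, γ i j * ‖x i - y j‖)
        (fun i _ => sum_nonneg fun j _ => ha i j) (mem_univ i))
  have hsum : ∑ i, ∑ j, μ i * ν j * ((γ i j / (μ i * ν j)) * ‖x i - y j‖) ^ ρ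
      ≤ C ^ (ρ - 1) * S ^ ρ := by
    calc _ ≤ ∑ i, ∑ j, γ i j * ‖x i - y j‖ * (C * S) ^ (ρ - 1) := by
          refine sum_le_sum fun i _ => sum_le_sum fun j _ => ?_
          rw [div_mul_eq_mul_div]
          exact mul_div_rpow_le hρ (mul_pos (hμ0 i) (hν0 j)) (ha i j) (hC i j) (haS i j)
      _ = S * (C * S) ^ (ρ - 1) := by simp only [← sum_mul, hS]
      _ = C ^ (ρ - 1) * (S * S ^ (ρ - 1)) := by
          rw [Real.mul_rpow hC0 hS0]
          ring
      _ = C ^ (ρ - 1) * S ^ ρ := by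
          rw [← Real.rpow_one_add' hS0 (by linarith)]
          ring_nf
  have hnonneg : 0 ≤ ∑ i, ∑ j, μ i * ν j * ((γ i j / (μ i * ν j)) * ‖x i - y j‖) ^ ρ := by
    refine sum_nonneg fun i _ => sum_nonneg fun j _ => ?_
    have := hμ0 i
    have := hν0 j
    have := hγ i j
    positivity
  calc transportCost x y μ ν ρ γ ≤ (C ^ (ρ - 1) * S ^ ρ) ^ (1 / ρ) :=
        Real.rpow_le_rpow hnonneg hsum (by positivity)
    _ = C ^ ((ρ - 1) / ρ) * S := by
        rw [Real.mul_rpow (by positivity) (by positivity), ← Real.rpow_mul hC0,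
          ← Real.rpow_mul hS0, mul_one_div, mul_one_div_cancel hρ0.ne', Real.rpow_one]

/-- The product coupling. -/
theorem isCoupling_mul {n m : ℕ} {μ : Fin n → ℝ} {ν : Fin m → ℝ}
    (hμ0 : ∀ i, 0 ≤ μ i) (hν0 : ∀ j, 0 ≤ ν j) (hμ1 : ∑ i, μ i = 1) (hν1 : ∑ j, ν j = 1) :
    IsCoupling μ ν fun i j => μ i * ν j :=
  ⟨fun i j => mul_nonneg (hμ0 i) (hν0 j), fun i => by rw [← mul_sum, hν1, mul_one],
    fun j => by rw [← sum_mul, hμ1, one_mul]⟩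

/-- `R_ρ(μ, ν) ≤ (sup_{i,j} 1/(μ_i ν_j))^{(ρ−1)/ρ} · EMD(μ, ν)`. -/
theorem Rrho_le_EMD {d n m : ℕ} (x : Fin n → EuclideanSpace ℝ (Fin d))
    (y : Fin m → EuclideanSpace ℝ (Fin d)) (ρ : ℝ) (hρ : 1 ≤ ρ)
    (μ : Fin n → ℝ) (ν : Fin m → ℝ)
    (hμ0 : ∀ i, 0 < μ i) (hν0 : ∀ j, 0 < ν j)
    (hμ1 : ∑ i, μ i = 1) (hν1 : ∑ j, ν j = 1) :
    Rrho x y μ ν ρ ≤ (⨆ i, ⨆ j, 1 / (μ i * ν j)) ^ ((ρ - 1) / ρ) * EMD x y μ ν := by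
  have hC : ∀ i j, 1 / (μ i * ν j) ≤ ⨆ i, ⨆ j, 1 / (μ i * ν j) := fun i j =>
    (le_ciSup (f := fun j => 1 / (μ i * ν j)) (Set.finite_range _).bddAbove j).trans
      (le_ciSup (f := fun i => ⨆ j, 1 / (μ i * ν j)) (Set.finite_range _).bddAbove i)
  obtain ⟨i₀, -⟩ := nonempty_of_sum_ne_zero (hμ1.trans_ne one_ne_zero)
  obtain ⟨j₀, -⟩ := nonempty_of_sum_ne_zero (hν1.trans_ne one_ne_zero)
  set C := ⨆ i, ⨆ j, 1 / (μ i * ν j)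
  have hC0 : 0 < C := (one_div_pos.2 (mul_pos (hμ0 i₀) (hν0 j₀))).trans_le (hC i₀ j₀)
  rw [← div_le_iff₀' (Real.rpow_pos_of_pos hC0 _)]
  refine le_csInf ⟨_, _, isCoupling_mul (fun i => (hμ0 i).le) (fun j => (hν0 j).le) hμ1 hν1, rfl⟩ ?_
  rintro _ ⟨γ, hγ, rfl⟩
  rw [div_le_iff₀' (Real.rpow_pos_of_pos hC0 _)]
  refine le_trans (csInf_le (a := transportCost x y μ ν ρ γ) ⟨0, ?_⟩ ⟨γ, hγ, rfl⟩)
    (transportCost_le x y hρ hμ0 hν0 hC0.le hC hγ.1)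
  rintro _ ⟨δ, hδ, rfl⟩
  refine Real.rpow_nonneg (sum_nonneg fun i _ => sum_nonneg fun j _ => ?_) _
  have := hμ0 i
  have := hν0 j
  have := hδ.1 i j
  positivity
end
end

section
/- (Weak duality for R_ρ^ρ.) Let ρ > 1 with Hölder conjugate s, let μ be a distribution with weights μ_i > 0 on points x_1,…,x_n ∈ ℝ^d and ν a distribution with weights ν_j > 0 on points y_1,…,y_m ∈ ℝ^d, with {x_1,…,x_n} and {y_1,…,y_m} disjoint. Then for every coupling γ of μ and ν and every α ∈ ℝ^n, β ∈ ℝ^m: g(α, β) ≤ Σ_{i,j} μ_i ν_j ((γ_{ij}/(μ_i ν_j))·‖x_i − y_j‖₂)^ρ. -/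
open Finset

noncomputable section

/-- The constant `C_s = (1/s)(1 − 1/s)^{s−1}`. -/
def Cs (s : ℝ) : ℝ := (1 / s) * (1 - 1 / s) ^ (s - 1)

/-- The dual objective `g(α, β)` for `R_ρ(μ, ν)^ρ`, with `s` the Hölder conjugate of `ρ`. -/
def dualObj {d n m : ℕ} (x : Fin n → EuclideanSpace ℝ (Fin d))
    (y : Fin m → EuclideanSpace ℝ (Fin d)) (μ : Fin n → ℝ) (ν : Fin m → ℝ) (s : ℝ)
    (α : Fin n → ℝ) (β : Fin m → ℝ) : ℝ :=
  ∑ i, μ i * α i - ∑ j, ν j * β j -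
    Cs s * ∑ i, ∑ j, μ i * ν j * (max (α i - β j) 0 / ‖x i - y j‖) ^ s

/-- Young's inequality in the unnormalized form `a * b ≤ a ^ ρ + C_s * b ^ s`. -/
lemma mul_le_rpow_add_Cs_mul_rpow {ρ s a b : ℝ} (h : ρ.HolderConjugate s)
    (ha : 0 ≤ a) (hb : 0 ≤ b) : a * b ≤ a ^ ρ + Cs s * b ^ s := by
  have hρ : 0 < ρ := h.pos
  set c : ℝ := ρ ^ (1 / ρ) with hc
  have hc0 : 0 < c := Real.rpow_pos_of_pos hρ _
  have hcρ : c ^ ρ = ρ := by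
    rw [hc, ← Real.rpow_mul hρ.le, one_div_mul_cancel hρ.ne', Real.rpow_one]
  have hcs : c ^ s = ρ ^ (s - 1) := by
    rw [hc, ← Real.rpow_mul hρ.le, one_div_mul_eq_div, ← h.symm.div_conj_eq_sub_one]
  have hCs : Cs s = (1 / s) * (ρ ^ (s - 1))⁻¹ := by
    rw [Cs, one_div s, h.symm.one_sub_inv, Real.inv_rpow hρ.le]
  have young := Real.young_inequality_of_nonneg
    (mul_nonneg hc0.le ha) (div_nonneg hb hc0.le) h
  rw [Real.mul_rpow hc0.le ha, Real.div_rpow hb hc0.le, hcρ, hcs] at young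
  calc a * b = c * a * (b / c) := by field_simp
    _ ≤ _ := young
    _ = _ := by rw [hCs]; field_simp

/-- Total profit of the potentials `α`, `β`, expressed through a coupling. -/
lemma IsCoupling.sum_mul_sub_sum_mul {n m : ℕ} {μ : Fin n → ℝ} {ν : Fin m → ℝ}
    {γ : Fin n → Fin m → ℝ} (hγ : IsCoupling μ ν γ) (α : Fin n → ℝ) (β : Fin m → ℝ) :
    ∑ i, μ i * α i - ∑ j, ν j * β j = ∑ i, ∑ j, γ i j * (α i - β j) := by
  obtain ⟨-, hμ, hν⟩ := hγ
  simp only [mul_sub, sum_sub_distrib]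
  rw [sum_comm (f := fun i j => γ i j * β j)]
  simp only [← sum_mul, hμ, hν]

/-- weak duality for `R_ρ^ρ`. -/
theorem weak_duality {d n m : ℕ} (x : Fin n → EuclideanSpace ℝ (Fin d))
    (y : Fin m → EuclideanSpace ℝ (Fin d)) (ρ s : ℝ) (hρ : 1 < ρ) (hs : 1 < s)
    (hconj : 1 / ρ + 1 / s = 1)
    (μ : Fin n → ℝ) (ν : Fin m → ℝ)
    (hμ0 : ∀ i, 0 < μ i) (hν0 : ∀ j, 0 < ν j)
    (hμ1 : ∑ i, μ i = 1) (hν1 : ∑ j, ν j = 1)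
    (hdisj : ∀ i j, x i ≠ y j)
    (γ : Fin n → Fin m → ℝ) (hγ : IsCoupling μ ν γ)
    (α : Fin n → ℝ) (β : Fin m → ℝ) :
    dualObj x y μ ν s α β ≤
      ∑ i, ∑ j, μ i * ν j * ((γ i j / (μ i * ν j)) * ‖x i - y j‖) ^ ρ := by
  have hH : ρ.HolderConjugate s :=
    Real.holderConjugate_iff.mpr ⟨hρ, by simpa only [one_div] using hconj⟩
  rw [dualObj, hγ.sum_mul_sub_sum_mul, sub_le_iff_le_add, mul_sum, ← sum_add_distrib]
  refine sum_le_sum fun i _ => ?_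
  rw [mul_sum, ← sum_add_distrib]
  refine sum_le_sum fun j _ => ?_
  have hw : 0 < μ i * ν j := mul_pos (hμ0 i) (hν0 j)
  have hr : 0 < ‖x i - y j‖ := norm_pos_iff.mpr (sub_ne_zero.mpr (hdisj i j))
  have young := mul_le_rpow_add_Cs_mul_rpow hH
    (mul_nonneg (div_nonneg (hγ.1 i j) hw.le) hr.le)
    (div_nonneg (le_max_right (α i - β j) 0) hr.le)
  calc γ i j * (α i - β j) ≤ γ i j * max (α i - β j) 0 :=
        mul_le_mul_of_nonneg_left (le_max_left _ _) (hγ.1 i j)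
    _ = μ i * ν j * (γ i j / (μ i * ν j) * ‖x i - y j‖ *
          (max (α i - β j) 0 / ‖x i - y j‖)) := by
        generalize μ i * ν j = w at hw
        field_simp
    _ ≤ _ := mul_le_mul_of_nonneg_left young hw.le
    _ = _ := by ring
end
end

section
/- (ℓ∞-bounded near-optimal dual variables.) Let ρ > 1 with Hölder conjugate s ≥ 2, let μ, ν be distributions with positive weights on disjoint point sets {x_1,…,x_n}, {y_1,…,y_m} ⊂ ℝ^d with max_{i,j} ‖x_i − y_j‖₂ ≤ r. If (α, β) ∈ ℝ^{n+m} satisfies g(α, β) ≥ 0, then there exists (α′, β′) ∈ ℝ^{n+m} with g(α′, β′) ≥ g(α, β) and max(‖α′‖_∞, ‖β′‖_∞) ≤ (4^{1/s}/2) · (sup_{i,j} 1/(μ_i ν_j))^{(ρ−1)/ρ} · r^ρ. -/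
open Finset

noncomputable section

lemma Cs_nonneg {s : ℝ} (hs : 1 ≤ s) : 0 ≤ Cs s := by
  have h : 1 / s ≤ 1 := by rw [div_le_one (by linarith)]; exact hs
  have h' : 0 ≤ 1 / s := by positivity
  unfold Cs
  exact mul_nonneg h' (Real.rpow_nonneg (by linarith) _)

/-- The tangent line inequality for the convex function `t ↦ t ^ s` at `T > 0`. -/
lemma rpow_tangent_le {s T D : ℝ} (hs : 1 ≤ s) (hT : 0 < T) (hD : 0 ≤ D) :
    T ^ s + s * T ^ (s - 1) * (D - T) ≤ D ^ s := by
  have h := one_add_mul_self_le_rpow_one_add (s := (D - T) / T)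
    (by rw [le_div_iff₀ hT]; linarith) hs
  have e : 1 + (D - T) / T = D / T := by field_simp; ring
  rw [e, Real.div_rpow hD hT.le, le_div_iff₀ (by positivity)] at h
  have e2 : T ^ s = T ^ (s - 1) * T := by
    rw [← Real.rpow_add_one hT.ne']; ring_nf
  calc T ^ s + s * T ^ (s - 1) * (D - T) = (1 + s * ((D - T) / T)) * T ^ s := by
        rw [e2]; field_simp
    _ ≤ D ^ s := h

lemma dualObj_eq_sum {d n m : ℕ} (x : Fin n → EuclideanSpace ℝ (Fin d))
    (y : Fin m → EuclideanSpace ℝ (Fin d)) (μ : Fin n → ℝ) (ν : Fin m → ℝ) (s : ℝ)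
    (α : Fin n → ℝ) (β : Fin m → ℝ) :
    dualObj x y μ ν s α β =
      ∑ i, μ i * (α i - Cs s * ∑ j, ν j * (max (α i - β j) 0 / ‖x i - y j‖) ^ s) -
        ∑ j, ν j * β j := by
  have h : Cs s * ∑ i, ∑ j, μ i * ν j * (max (α i - β j) 0 / ‖x i - y j‖) ^ s =
      ∑ i, μ i * (Cs s * ∑ j, ν j * (max (α i - β j) 0 / ‖x i - y j‖) ^ s) := by
    simp only [Finset.mul_sum]
    exact Finset.sum_congr rfl fun i _ => Finset.sum_congr rfl fun j _ => by ring
  simp only [dualObj, h, mul_sub, Finset.sum_sub_distrib]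
  ring

lemma dualObj_swap {d n m : ℕ} (x : Fin n → EuclideanSpace ℝ (Fin d))
    (y : Fin m → EuclideanSpace ℝ (Fin d)) (μ : Fin n → ℝ) (ν : Fin m → ℝ) (s : ℝ)
    (α : Fin n → ℝ) (β : Fin m → ℝ) :
    dualObj y x ν μ s (-β) (-α) = dualObj x y μ ν s α β := by
  unfold dualObj
  rw [Finset.sum_comm (s := (univ : Finset (Fin m)))]
  have h : ∀ i j, μ i * ν j * (max (α i - β j) 0 / ‖x i - y j‖) ^ s =
      ν j * μ i * (max ((-β) j - (-α) i) 0 / ‖y j - x i‖) ^ s := fun i j => by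
    rw [norm_sub_rev, mul_comm (μ i), Pi.neg_apply, Pi.neg_apply, neg_sub_neg]
  simp only [h, Pi.neg_apply, mul_neg, Finset.sum_neg_distrib]
  ring

lemma dualObj_sub_const {d n m : ℕ} (x : Fin n → EuclideanSpace ℝ (Fin d))
    (y : Fin m → EuclideanSpace ℝ (Fin d)) {μ : Fin n → ℝ} {ν : Fin m → ℝ} (s : ℝ)
    (h : ∑ i, μ i = ∑ j, ν j) (α : Fin n → ℝ) (β : Fin m → ℝ) (c : ℝ) :
    dualObj x y μ ν s (fun i => α i - c) (fun j => β j - c) = dualObj x y μ ν s α β := by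
  simp only [dualObj, sub_sub_sub_cancel_right, mul_sub, Finset.sum_sub_distrib,
    ← Finset.sum_mul, h]

/-- Lowering one variable `α i` from above `β j₀ + T` to `β j₀ + T` does not decrease its
contribution to the dual objective, provided `T` is large in terms of the weight of `j₀`. -/
lemma row_le_of_gap {d m : ℕ} (p : EuclideanSpace ℝ (Fin d))
    (y : Fin m → EuclideanSpace ℝ (Fin d)) {ν : Fin m → ℝ} {s r T a : ℝ} {β : Fin m → ℝ}
    {j₀ : Fin m} (hs : 1 ≤ s) (hν : ∀ j, 0 ≤ ν j) (hp : p ≠ y j₀) (hr : ‖p - y j₀‖ ≤ r)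
    (hT : 0 < T) (hbig : r ^ s ≤ ν j₀ * (Cs s * (s * T ^ (s - 1)))) (ha : β j₀ + T ≤ a) :
    a - Cs s * ∑ j, ν j * (max (a - β j) 0 / ‖p - y j‖) ^ s ≤
      β j₀ + T - Cs s * ∑ j, ν j * (max (β j₀ + T - β j) 0 / ‖p - y j‖) ^ s := by
  have hC := Cs_nonneg hs
  have hd : 0 < ‖p - y j₀‖ := norm_pos_iff.2 (sub_ne_zero.2 hp)
  have hsum : ν j₀ * (max (a - β j₀) 0 / ‖p - y j₀‖) ^ s -
        ν j₀ * (max (β j₀ + T - β j₀) 0 / ‖p - y j₀‖) ^ s ≤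
      ∑ j, (ν j * (max (a - β j) 0 / ‖p - y j‖) ^ s -
        ν j * (max (β j₀ + T - β j) 0 / ‖p - y j‖) ^ s) := by
    refine Finset.single_le_sum (f := fun j => ν j * (max (a - β j) 0 / ‖p - y j‖) ^ s -
        ν j * (max (β j₀ + T - β j) 0 / ‖p - y j‖) ^ s) (fun j _ => sub_nonneg.2 ?_)
      (mem_univ j₀)
    have := hν j
    gcongr
  rw [Finset.sum_sub_distrib, add_sub_cancel_left, max_eq_left hT.le,
    max_eq_left (by linarith), Real.div_rpow (by linarith) hd.le, Real.div_rpow hT.le hd.le] at hsum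
  have htan := rpow_tangent_le hs hT (show 0 ≤ a - β j₀ by linarith)
  have hds : ‖p - y j₀‖ ^ s ≤ r ^ s := Real.rpow_le_rpow hd.le hr (by linarith)
  have hds0 : 0 < ‖p - y j₀‖ ^ s := Real.rpow_pos_of_pos hd s
  have hkey : a - (β j₀ + T) ≤ Cs s * (ν j₀ * ((a - β j₀) ^ s / ‖p - y j₀‖ ^ s) -
      ν j₀ * (T ^ s / ‖p - y j₀‖ ^ s)) := by
    rw [← mul_sub, ← sub_div, ← mul_div_assoc, ← mul_div_assoc, le_div_iff₀ hds0]
    calc (a - (β j₀ + T)) * ‖p - y j₀‖ ^ s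
        ≤ (a - (β j₀ + T)) * (ν j₀ * (Cs s * (s * T ^ (s - 1)))) :=
          mul_le_mul_of_nonneg_left (hds.trans hbig) (by linarith)
      _ = Cs s * (ν j₀ * (s * T ^ (s - 1) * (a - β j₀ - T))) := by ring
      _ ≤ Cs s * (ν j₀ * ((a - β j₀) ^ s - T ^ s)) :=
          mul_le_mul_of_nonneg_left
            (mul_le_mul_of_nonneg_left (by linarith) (hν j₀)) hC
  have := mul_le_mul_of_nonneg_left hsum hC
  linarith

/-- If the weight of a minimizer `j₀` of `β` is large enough, the dual variables can be
confined to the interval `[β j₀, β j₀ + T]` without decreasing the dual objective. -/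
lemma exists_dualObj_le_of_min {d n m : ℕ} (x : Fin n → EuclideanSpace ℝ (Fin d))
    (y : Fin m → EuclideanSpace ℝ (Fin d)) {μ : Fin n → ℝ} {ν : Fin m → ℝ} {s r T : ℝ}
    (α : Fin n → ℝ) {β : Fin m → ℝ} {j₀ : Fin m} (hs : 1 ≤ s) (hμ : ∀ i, 0 ≤ μ i)
    (hν : ∀ j, 0 ≤ ν j) (hxy : ∀ i, x i ≠ y j₀) (hr : ∀ i, ‖x i - y j₀‖ ≤ r) (hT : 0 < T)
    (hbig : r ^ s ≤ ν j₀ * (Cs s * (s * T ^ (s - 1)))) (hmin : ∀ j, β j₀ ≤ β j) :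
    ∃ (α' : Fin n → ℝ) (β' : Fin m → ℝ), dualObj x y μ ν s α β ≤ dualObj x y μ ν s α' β' ∧
      (∀ i, α' i ∈ Set.Icc (β j₀) (β j₀ + T)) ∧ ∀ j, β' j ∈ Set.Icc (β j₀) (β j₀ + T) := by
  refine ⟨fun i => max (β j₀) (min (α i) (β j₀ + T)), fun j => min (β j) (β j₀ + T), ?_,
    fun i => ⟨le_max_left _ _, max_le (by linarith) (min_le_right _ _)⟩,
    fun j => ⟨le_min (hmin j) (by linarith), min_le_right _ _⟩⟩
  have hpos : ∀ a ≤ β j₀ + T, ∀ j, max (a - min (β j) (β j₀ + T)) 0 = max (a - β j) 0 := by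
    intro a ha j
    rcases le_total (β j) (β j₀ + T) with h | h
    · rw [min_eq_left h]
    · rw [min_eq_right h, max_eq_right (by linarith), max_eq_right (by linarith)]
  rw [dualObj_eq_sum, dualObj_eq_sum]
  refine sub_le_sub (Finset.sum_le_sum fun i _ => mul_le_mul_of_nonneg_left ?_ (hμ i))
    (Finset.sum_le_sum fun j _ => mul_le_mul_of_nonneg_left (min_le_left _ _) (hν j))
  simp only [hpos _ (max_le (by linarith : β j₀ ≤ β j₀ + T) (min_le_right (α i) _))]
  rcases le_total (α i) (β j₀ + T) with h | h
  · rw [min_eq_left h]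
    rcases le_total (β j₀) (α i) with h' | h'
    · rw [max_eq_right h']
    · rw [max_eq_left h']
      have e : ∀ j, max (α i - β j) 0 = max (β j₀ - β j) 0 := fun j => by
        have := hmin j
        rw [max_eq_right (by linarith), max_eq_right (by linarith)]
      simp only [e]
      linarith
  · rw [min_eq_right h, max_eq_right (by linarith)]
    exact row_le_of_gap (x i) y hs hν (hxy i) (hr i) hT hbig h

/-- For Hölder conjugate exponents with `s ≥ 2`, one has `ρ ≤ 4 ^ (1 / s)`. -/
lemma conjExponent_le_four_rpow {ρ s : ℝ} (hs : 2 ≤ s) (hconj : 1 / ρ + 1 / s = 1) :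
    ρ ≤ 4 ^ (1 / s) := by
  have hs0 : 0 < s := by linarith
  have hs1 : 1 / s ≤ 1 / 2 := one_div_le_one_div_of_le (by norm_num) hs
  have hinv : 1 + -(1 / s) = 1 / ρ := by linarith
  have hρ : 0 < ρ := one_div_pos.1 (by linarith)
  have h := one_add_mul_self_le_rpow_one_add (s := -(1 / s)) (p := s / 2)
    (by linarith) (by linarith)
  rw [hinv, show 1 + s / 2 * -(1 / s) = (1 / 2 : ℝ) by field_simp; norm_num] at h
  have h2 := Real.rpow_le_rpow (by norm_num) h (show 0 ≤ 2 * (1 / s) by positivity)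
  rw [← Real.rpow_mul (by positivity), show s / 2 * (2 * (1 / s)) = 1 by field_simp,
    Real.rpow_one, Real.rpow_mul (by norm_num), show (1 / 2 : ℝ) ^ (2 : ℝ) = 1 / 4 by norm_num,
    Real.div_rpow (by norm_num) (by norm_num), Real.one_rpow] at h2
  exact (one_div_le_one_div (by positivity) hρ).1 h2

lemma rpow_le_mul_Cs_mul {ρ s r K w : ℝ} (hρ : 1 < ρ) (hs : 2 ≤ s)
    (hconj : 1 / ρ + 1 / s = 1) (hr : 0 < r) (hK : 1 ≤ K) (hw : 1 ≤ w * √K) :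
    r ^ s ≤ w * (Cs s * (s * ((4 : ℝ) ^ (1 / s) * K ^ ((ρ - 1) / ρ) * r ^ ρ) ^ (s - 1))) := by
  have hρ0 : 0 < ρ := by linarith
  have hs0 : 0 < s := by linarith
  have hK0 : 0 < K := by linarith
  have hw0 : 0 ≤ w := by
    by_contra! h
    nlinarith [Real.sqrt_nonneg K]
  have hinv : 1 - 1 / s = 1 / ρ := by linarith
  have hmul : ρ * s = ρ + s := by field_simp at hconj; linarith
  have hexp : (1 : ℝ) / 2 ≤ (ρ - 1) / ρ * (s - 1) := by
    have : (ρ - 1) / ρ = 1 / s := by rw [sub_div, div_self hρ0.ne']; linarith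
    rw [this, one_div_mul_eq_div, div_le_div_iff₀ (by norm_num) hs0]
    linarith
  have hCs : Cs s * s = (1 / ρ) ^ (s - 1) := by
    unfold Cs
    rw [hinv]
    field_simp
  have h4 := conjExponent_le_four_rpow hs hconj
  have hbase : K ^ ((ρ - 1) / ρ) * r ^ ρ ≤
      1 / ρ * ((4 : ℝ) ^ (1 / s) * K ^ ((ρ - 1) / ρ) * r ^ ρ) := by
    rw [one_div_mul_eq_div, le_div_iff₀ hρ0, mul_comm, ← mul_assoc]
    gcongr
  calc r ^ s = 1 * r ^ s := (one_mul _).symm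
    _ ≤ w * K ^ ((ρ - 1) / ρ * (s - 1)) * r ^ s := by
        gcongr
        refine hw.trans (mul_le_mul_of_nonneg_left ?_ hw0)
        rw [Real.sqrt_eq_rpow]
        exact Real.rpow_le_rpow_of_exponent_le hK hexp
    _ = w * (K ^ ((ρ - 1) / ρ) * r ^ ρ) ^ (s - 1) := by
        rw [Real.mul_rpow (by positivity) (by positivity), ← Real.rpow_mul hK0.le,
          ← Real.rpow_mul hr.le, mul_assoc, show ρ * (s - 1) = s by linarith]
    _ ≤ w * (1 / ρ * ((4 : ℝ) ^ (1 / s) * K ^ ((ρ - 1) / ρ) * r ^ ρ)) ^ (s - 1) := by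
        exact mul_le_mul_of_nonneg_left
          (Real.rpow_le_rpow (by positivity) hbase (by linarith)) hw0
    _ = w * (Cs s * (s * ((4 : ℝ) ^ (1 / s) * K ^ ((ρ - 1) / ρ) * r ^ ρ) ^ (s - 1))) := by
        rw [Real.mul_rpow (by positivity) (by positivity), ← hCs, mul_assoc]

/-- ℓ∞-bounded near-optimal dual variables. (For `α : Fin n → ℝ`, the norm
`‖α‖` is the sup norm `max_i |α i|`.) -/
theorem bounded_dual_variables {d n m : ℕ} (x : Fin n → EuclideanSpace ℝ (Fin d))
    (y : Fin m → EuclideanSpace ℝ (Fin d)) (ρ s : ℝ) (hρ : 1 < ρ) (hs : 2 ≤ s)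
    (hconj : 1 / ρ + 1 / s = 1)
    (μ : Fin n → ℝ) (ν : Fin m → ℝ)
    (hμ0 : ∀ i, 0 < μ i) (hν0 : ∀ j, 0 < ν j)
    (hμ1 : ∑ i, μ i = 1) (hν1 : ∑ j, ν j = 1)
    (hdisj : ∀ i j, x i ≠ y j)
    (r : ℝ) (hr : ∀ i j, ‖x i - y j‖ ≤ r)
    (α : Fin n → ℝ) (β : Fin m → ℝ)
    (hg : 0 ≤ dualObj x y μ ν s α β) :
    ∃ (α' : Fin n → ℝ) (β' : Fin m → ℝ),
      dualObj x y μ ν s α β ≤ dualObj x y μ ν s α' β' ∧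
      max ‖α'‖ ‖β'‖ ≤
        (4 : ℝ) ^ (1 / s) / 2 * (⨆ i, ⨆ j, 1 / (μ i * ν j)) ^ ((ρ - 1) / ρ) * r ^ ρ := by
  have hn : Nonempty (Fin n) := by
    by_contra h
    rw [not_nonempty_iff] at h
    simp at hμ1
  have hm : Nonempty (Fin m) := by
    by_contra h
    rw [not_nonempty_iff] at h
    simp at hν1
  obtain ⟨i₀, hi₀⟩ := Finite.exists_max α
  obtain ⟨j₀, hj₀⟩ := Finite.exists_min β
  have hr0 : 0 < r := (norm_pos_iff.2 (sub_ne_zero.2 (hdisj i₀ j₀))).trans_le (hr i₀ j₀)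
  set K : ℝ := ⨆ i, ⨆ j, 1 / (μ i * ν j)
  have hK : 1 / (μ i₀ * ν j₀) ≤ K :=
    (le_ciSup (f := fun j => 1 / (μ i₀ * ν j)) (Set.finite_range _).bddAbove j₀).trans
      (le_ciSup (f := fun i => ⨆ j, 1 / (μ i * ν j)) (Set.finite_range _).bddAbove i₀)
  have hμle : μ i₀ ≤ 1 := hμ1 ▸ Finset.single_le_sum (fun i _ => (hμ0 i).le) (mem_univ i₀)
  have hνle : ν j₀ ≤ 1 := hν1 ▸ Finset.single_le_sum (fun j _ => (hν0 j).le) (mem_univ j₀)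
  have hprod : 0 < μ i₀ * ν j₀ := mul_pos (hμ0 i₀) (hν0 j₀)
  have hK1 : 1 ≤ K := by
    refine le_trans ?_ hK
    rw [le_div_iff₀ hprod, one_mul]
    exact mul_le_one₀ hμle (hν0 j₀).le hνle
  have hK0 : 0 < K := by linarith
  set T : ℝ := (4 : ℝ) ^ (1 / s) * K ^ ((ρ - 1) / ρ) * r ^ ρ with hTdef
  have hT : 0 < T := by positivity
  have hbound : (4 : ℝ) ^ (1 / s) / 2 * K ^ ((ρ - 1) / ρ) * r ^ ρ = T / 2 := by
    rw [hTdef]; ring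
  have hs1 : 1 ≤ s := by linarith
  suffices h : ∃ (c : ℝ) (α' : Fin n → ℝ) (β' : Fin m → ℝ),
      dualObj x y μ ν s α β ≤ dualObj x y μ ν s α' β' ∧
      (∀ i, α' i ∈ Set.Icc c (c + T)) ∧ ∀ j, β' j ∈ Set.Icc c (c + T) by
    obtain ⟨c, α', β', hle, hα', hβ'⟩ := h
    refine ⟨fun i => α' i - (c + T / 2), fun j => β' j - (c + T / 2), ?_, ?_⟩
    · rwa [dualObj_sub_const x y s (hμ1.trans hν1.symm)]
    · rw [hbound]
      refine max_le ((pi_norm_le_iff_of_nonneg (by positivity)).2 fun i => ?_)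
        ((pi_norm_le_iff_of_nonneg (by positivity)).2 fun j => ?_)
      · have := hα' i
        rw [Real.norm_eq_abs, abs_le]
        constructor <;> linarith [this.1, this.2]
      · have := hβ' j
        rw [Real.norm_eq_abs, abs_le]
        constructor <;> linarith [this.1, this.2]
  have hsplit : 1 ≤ ν j₀ * √K ∨ 1 ≤ μ i₀ * √K := by
    by_contra! h
    have h1 : μ i₀ * √K * (ν j₀ * √K) < 1 :=
      mul_lt_one_of_nonneg_of_lt_one_left (mul_nonneg (hμ0 i₀).le (Real.sqrt_nonneg K))
        h.2 h.1.le
    rw [div_le_iff₀ hprod] at hK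
    nlinarith [Real.mul_self_sqrt hK0.le]
  rcases hsplit with h | h
  · obtain ⟨α', β', h'⟩ := exists_dualObj_le_of_min x y α hs1 (fun i => (hμ0 i).le)
      (fun j => (hν0 j).le) (fun i => hdisj i j₀) (fun i => hr i j₀) hT
      (rpow_le_mul_Cs_mul hρ hs hconj hr0 hK1 h) hj₀
    exact ⟨_, α', β', h'⟩
  · obtain ⟨β', α', hle, hβ', hα'⟩ := exists_dualObj_le_of_min y x (μ := ν) (-β) (β := -α) hs1
      (fun j => (hν0 j).le) (fun i => (hμ0 i).le) (fun j => (hdisj i₀ j).symm)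
      (fun j => norm_sub_rev (x i₀) (y j) ▸ hr i₀ j) hT
      (rpow_le_mul_Cs_mul hρ hs hconj hr0 hK1 h) (fun i => neg_le_neg (hi₀ i))
    refine ⟨α i₀ - T, -α', -β', ?_, fun i => ?_, fun j => ?_⟩
    · rwa [dualObj_swap, ← dualObj_swap y x] at hle
    · have := hα' i
      simp only [Pi.neg_apply, Set.mem_Icc] at this ⊢
      constructor <;> linarith [this.1, this.2]
    · have := hβ' j
      simp only [Pi.neg_apply, Set.mem_Icc] at this ⊢
      constructor <;> linarith [this.1, this.2]
end
end

section
/- (Bounded penalty gradient, second bound.) Let ρ ∈ (1, 2) with Hölder conjugate s > 2, let μ, ν be distributions with positive weights on disjoint point sets {x_1,…,x_n}, {y_1,…,y_m} ⊂ ℝ^d, and suppose r_min ≤ ‖x_i − y_j‖₂ ≤ r for all i, j, where 0 < r_min ≤ r. If (α, β) ∈ ℝ^{n+m} satisfies g(α, β) ≥ 0, then C_s Σ_{i,j} μ_i ν_j ((α_i − β_j)^+)^{s−2} / ‖x_i − y_j‖₂^s ≤ 4·r^{2−ρ} / r_min². -/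
open Finset

noncomputable section

theorem sum_mul_rpow_le_rpow_sum {ι : Type*} [Fintype ι] (w z : ι → ℝ) (hw : ∀ i, 0 ≤ w i)
    (hw1 : ∑ i, w i = 1) (hz : ∀ i, 0 ≤ z i) {p q : ℝ} (hp : 0 < p) (hpq : p ≤ q) :
    ∑ i, w i * z i ^ p ≤ (∑ i, w i * z i ^ q) ^ (p / q) := by
  have hq : 0 < q := hp.trans_le hpq
  have h := Real.rpow_arith_mean_le_arith_mean_rpow univ w (fun i => z i ^ p)
    (fun i _ => hw i) hw1 (fun i _ => Real.rpow_nonneg (hz i) p) ((one_le_div hp).2 hpq)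
  have hz' : ∀ i, (z i ^ p) ^ (q / p) = z i ^ q := fun i => by
    rw [← Real.rpow_mul (hz i), mul_div_cancel₀ _ hp.ne']
  simp only [hz'] at h
  have h0 : 0 ≤ ∑ i, w i * z i ^ p :=
    sum_nonneg fun i _ => mul_nonneg (hw i) (Real.rpow_nonneg (hz i) p)
  have h2 := Real.rpow_le_rpow (Real.rpow_nonneg h0 _) h (div_pos hp hq).le
  rwa [← Real.rpow_mul h0, div_mul_div_cancel₀ hp.ne', div_self hq.ne', Real.rpow_one] at h2

theorem Cs_pos {s : ℝ} (hs : 1 < s) : 0 < Cs s := by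
  have : 1 / s < 1 := (div_lt_one (by linarith)).2 hs
  exact mul_pos (by positivity) (Real.rpow_pos_of_pos (by linarith) _)

theorem Cs_le_one {s : ℝ} (hs : 1 < s) : Cs s ≤ 1 := by
  have h1 : 1 / s < 1 := (div_lt_one (by linarith)).2 hs
  have h0 : 0 < 1 / s := by positivity
  exact mul_le_one₀ h1.le (Real.rpow_nonneg (by linarith) _)
    (Real.rpow_le_one (by linarith) (by linarith) (by linarith))

/-- If `c B ^ s ≤ r B`, then `c B ^ (s - 2)` is controlled by `r ^ (2 - ρ)`. -/
theorem mul_rpow_sub_two_le {c B r ρ s : ℝ} (hc : 0 < c) (hc1 : c ≤ 1) (hB : 0 ≤ B) (hr : 0 < r)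
    (hρ1 : 1 < ρ) (hs : 2 < s) (hconj : 1 / ρ + 1 / s = 1) (h : c * B ^ s ≤ r * B) :
    c * B ^ (s - 2) ≤ r ^ (2 - ρ) := by
  rcases hB.eq_or_lt with rfl | hB
  · rw [Real.zero_rpow (by linarith), mul_zero]
    positivity
  have hexp : s - 2 = (s - 1) * (2 - ρ) := by
    field_simp at hconj
    linarith
  have hρ2 : 0 < 2 - ρ := pos_of_mul_pos_right (hexp ▸ by linarith) (by linarith : 0 ≤ s - 1)
  have hB1 : c * B ^ (s - 1) ≤ r := by
    rw [Real.rpow_sub_one hB.ne', ← mul_div_assoc, div_le_iff₀ hB]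
    exact h
  calc c * B ^ (s - 2) ≤ c ^ (2 - ρ) * (B ^ (s - 1)) ^ (2 - ρ) := by
        rw [hexp, Real.rpow_mul hB.le]
        gcongr
        exact Real.self_le_rpow_of_le_one hc.le hc1 (by linarith)
    _ = (c * B ^ (s - 1)) ^ (2 - ρ) := by rw [Real.mul_rpow hc.le (by positivity)]
    _ ≤ r ^ (2 - ρ) := by gcongr

theorem sum_mul_sub_sum_mul_eq {ι κ : Type*} [Fintype ι] [Fintype κ] (μ α : ι → ℝ)
    (ν β : κ → ℝ) (hμ1 : ∑ i, μ i = 1) (hν1 : ∑ j, ν j = 1) :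
    ∑ i, μ i * α i - ∑ j, ν j * β j = ∑ i, ∑ j, μ i * ν j * (α i - β j) := by
  have h1 : ∑ i, ∑ j, μ i * ν j * α i = ∑ i, μ i * α i := by
    refine sum_congr rfl fun i _ => ?_
    rw [← sum_mul, ← mul_sum, hν1, mul_one]
  have h2 : ∑ i, ∑ j, μ i * ν j * β j = ∑ j, ν j * β j := by
    rw [sum_comm]
    refine sum_congr rfl fun j _ => ?_
    rw [← sum_mul, ← sum_mul, hμ1, one_mul]
  simp only [mul_sub, sum_sub_distrib, h1, h2]

/-- bounded penalty gradient, second bound. -/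
theorem bounded_penalty_grad_two {d n m : ℕ} (x : Fin n → EuclideanSpace ℝ (Fin d))
    (y : Fin m → EuclideanSpace ℝ (Fin d)) (ρ s : ℝ) (hρ1 : 1 < ρ) (hρ2 : ρ < 2) (hs : 2 < s)
    (hconj : 1 / ρ + 1 / s = 1)
    (μ : Fin n → ℝ) (ν : Fin m → ℝ)
    (hμ0 : ∀ i, 0 < μ i) (hν0 : ∀ j, 0 < ν j)
    (hμ1 : ∑ i, μ i = 1) (hν1 : ∑ j, ν j = 1)
    (hdisj : ∀ i j, x i ≠ y j)
    (rmin r : ℝ) (hrmin : 0 < rmin) (hrr : rmin ≤ r)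
    (hlo : ∀ i j, rmin ≤ ‖x i - y j‖) (hhi : ∀ i j, ‖x i - y j‖ ≤ r)
    (α : Fin n → ℝ) (β : Fin m → ℝ)
    (hg : 0 ≤ dualObj x y μ ν s α β) :
    Cs s * ∑ i, ∑ j, μ i * ν j * (max (α i - β j) 0 ^ (s - 2) / ‖x i - y j‖ ^ s) ≤
      4 * r ^ (2 - ρ) / rmin ^ 2 := by
  have hs0 : 0 < s := by linarith
  have hr : 0 < r := hrmin.trans_le hrr
  have hc := Cs_pos (s := s) (by linarith)
  have hD : ∀ i j, 0 < ‖x i - y j‖ := fun i j => hrmin.trans_le (hlo i j)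
  let w : Fin n × Fin m → ℝ := fun k => μ k.1 * ν k.2
  let u : Fin n × Fin m → ℝ := fun k => max (α k.1 - β k.2) 0 / ‖x k.1 - y k.2‖
  have hw : ∀ k, 0 ≤ w k := fun k => (mul_pos (hμ0 _) (hν0 _)).le
  have hu : ∀ k, 0 ≤ u k := fun k => div_nonneg (le_max_right _ _) (norm_nonneg _)
  have hw1 : ∑ k, w k = 1 := by
    simp only [w, Fintype.sum_prod_type, ← mul_sum, hν1, mul_one, hμ1]
  let A := ∑ k, w k * u k ^ s
  have hA : 0 ≤ A := sum_nonneg fun k _ => mul_nonneg (hw k) (Real.rpow_nonneg (hu k) s)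
  have hmean : ∑ k, w k * u k ≤ A ^ (1 / s) := by
    simpa using sum_mul_rpow_le_rpow_sum w u hw hw1 hu one_pos (by linarith : (1 : ℝ) ≤ s)
  have hpow : ∑ k, w k * u k ^ (s - 2) ≤ (A ^ (1 / s)) ^ (s - 2) := by
    rw [← Real.rpow_mul hA, one_div_mul_eq_div]
    exact sum_mul_rpow_le_rpow_sum w u hw hw1 hu (by linarith) (by linarith)
  have hgA : Cs s * A ≤ ∑ i, ∑ j, μ i * ν j * (α i - β j) := by
    rw [← sum_mul_sub_sum_mul_eq μ α ν β hμ1 hν1]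
    simp only [A, w, u, Fintype.sum_prod_type]
    exact sub_nonneg.1 hg
  have hlin : ∑ i, ∑ j, μ i * ν j * (α i - β j) ≤ r * ∑ k, w k * u k := by
    rw [← Fintype.sum_prod_type' (fun i j => μ i * ν j * (α i - β j)), mul_sum]
    refine sum_le_sum fun k _ => ?_
    rw [mul_left_comm]
    refine mul_le_mul_of_nonneg_left ?_ (hw k)
    calc α k.1 - β k.2 ≤ max (α k.1 - β k.2) 0 := le_max_left _ _
      _ = ‖x k.1 - y k.2‖ * u k := (mul_div_cancel₀ _ (hD _ _).ne').symm
      _ ≤ r * u k := mul_le_mul_of_nonneg_right (hhi _ _) (hu k)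
  have hkey : Cs s * (A ^ (1 / s)) ^ (s - 2) ≤ r ^ (2 - ρ) := by
    refine mul_rpow_sub_two_le hc (Cs_le_one (by linarith)) (by positivity) hr hρ1 hs hconj ?_
    rw [← Real.rpow_mul hA, one_div_mul_cancel hs0.ne', Real.rpow_one]
    exact hgA.trans (hlin.trans (mul_le_mul_of_nonneg_left hmean hr.le))
  have hterm : ∑ i, ∑ j, μ i * ν j * (max (α i - β j) 0 ^ (s - 2) / ‖x i - y j‖ ^ s) ≤
      (∑ k, w k * u k ^ (s - 2)) / rmin ^ 2 := by
    rw [← Fintype.sum_prod_type'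
      (fun i j => μ i * ν j * (max (α i - β j) 0 ^ (s - 2) / ‖x i - y j‖ ^ s)), sum_div]
    refine sum_le_sum fun k _ => ?_
    rw [mul_div_assoc]
    refine mul_le_mul_of_nonneg_left ?_ (hw k)
    have hsplit : ‖x k.1 - y k.2‖ ^ s = ‖x k.1 - y k.2‖ ^ (s - 2) * ‖x k.1 - y k.2‖ ^ 2 := by
      rw [← Real.rpow_natCast, ← Real.rpow_add (hD _ _)]
      norm_num
    rw [hsplit, ← div_div, ← Real.div_rpow (le_max_right _ _) (norm_nonneg _)]
    exact div_le_div_of_nonneg_left (Real.rpow_nonneg (hu k) _) (by positivity)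
      (pow_le_pow_left₀ hrmin.le (hlo _ _) 2)
  calc _ ≤ Cs s * ((A ^ (1 / s)) ^ (s - 2) / rmin ^ 2) := by
        refine mul_le_mul_of_nonneg_left (hterm.trans ?_) hc.le
        gcongr
    _ = Cs s * (A ^ (1 / s)) ^ (s - 2) / rmin ^ 2 := (mul_div_assoc _ _ _).symm
    _ ≤ 4 * r ^ (2 - ρ) / rmin ^ 2 := by
        refine div_le_div_of_nonneg_right (hkey.trans ?_) (by positivity)
        linarith [Real.rpow_nonneg hr.le (2 - ρ)]
end
end
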